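/- Let R be a commutative ring, let α, β be units of R, let p ∈ R, and let I be an ideal of R with p ∈ I. Set a := α + β + pα⁻¹ + pβ⁻¹ and b := αβ + pαβ⁻¹ + pβα⁻¹ + p²(αβ)⁻¹. If α − β ∈ I, then 4b − a² ∈ I. -/

import Mathlib

/-- For a commutative ring `R`, units `α, β`, `p ∈ R`, an ideal `I`
containing `p`, `a = α + β + pα⁻¹ + pβ⁻¹` and `b = αβ + pαβ⁻¹ + pβα⁻¹ + p²(αβ)⁻¹`:
if `α ≡ β mod I` then `4b − a² ∈ I`. -/
theorem stmt_6 (R : Type*) [CommRing R] (α β : Rˣ) (p : R) (I : Ideal R) (hp : p ∈ I)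
    (a b : R)
    (ha : a = (α : R) + (β : R) + p * ((α⁻¹ : Rˣ) : R) + p * ((β⁻¹ : Rˣ) : R))
    (hb : b = (α : R) * (β : R) + p * (α : R) * ((β⁻¹ : Rˣ) : R)
      + p * (β : R) * ((α⁻¹ : Rˣ) : R) + p ^ 2 * (((α * β)⁻¹ : Rˣ) : R))
    (h : (α : R) - (β : R) ∈ I) :
    4 * b - a ^ 2 ∈ I := by
  have key : 4 * b - a ^ 2 = -((α : R) - β) * ((α : R) - β)
      + (4 * ((α : R) * ((β⁻¹ : Rˣ) : R) + (β : R) * ((α⁻¹ : Rˣ) : R)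
          + p * (((α * β)⁻¹ : Rˣ) : R))
        - 2 * ((α : R) + β) * (((α⁻¹ : Rˣ) : R) + ((β⁻¹ : Rˣ) : R))
        - p * (((α⁻¹ : Rˣ) : R) + ((β⁻¹ : Rˣ) : R)) ^ 2) * p := by
    rw [ha, hb]
    ring
  rw [key]
  exact I.add_mem (I.mul_mem_left _ h) (I.mul_mem_left _ hp)
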